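/- There exist a constant C > 0 and a real X₀ such that for every real x ≥ X₀ there is a lucky number l with x ≤ l ≤ x + C·√(x·log x). -/

import Mathlib

open scoped BigOperators

namespace LuckyPaper

/-- Rank of `k` in `A`: the number of elements of `A` that are `≤ k`
(the 1-indexed position of `k` in `A` when `k ∈ A`). -/
noncomputable def rank (A : Set ℕ) (k : ℕ) : ℕ := Set.ncard {m | m ∈ A ∧ m ≤ k}

/-- One sieve step: delete every `d`-th element of `A` (listed in increasing order). -/
noncomputable def step (A : Set ℕ) (d : ℕ) : Set ℕ := {k | k ∈ A ∧ ¬ d ∣ rank A k}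

/-- The lucky sieve: `sieve i = (A_i, l_i)`, where `A_0 = {1,2,3,…}`, `l_0 = 1` (dummy),
`l_{i+1}` is the smallest element of `A_i` larger than `l_i`, and `A_{i+1}` is obtained
from `A_i` by deleting every `l_{i+1}`-th element.  In particular `l_1 = 2`. -/
noncomputable def sieve : ℕ → Set ℕ × ℕ
  | 0 => ({n | 1 ≤ n}, 1)
  | i + 1 =>
      let p := sieve i
      let d := sInf {m | m ∈ p.1 ∧ p.2 < m}
      (step p.1 d, d)

/-- `A i` : the set of survivors after `i` steps of the lucky sieve. -/
noncomputable def A (i : ℕ) : Set ℕ := (sieve i).1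

/-- `l i` : the `i`-th sieve parameter (`l 1 = 2`, `l 2 = 3`, `l 3 = 7`, `l 4 = 9`, …);
with this convention `l n` is the `n`-th lucky number for `n ≥ 2`. -/
noncomputable def l (i : ℕ) : ℕ := (sieve i).2

/-- The set of lucky numbers `A_∞ = ⋂ i, A i = {1, 3, 7, 9, 13, 15, 21, 25, …}`. -/
noncomputable def LuckySet : Set ℕ := ⋂ i, A i

/-- `L x` : the number of lucky numbers that are `≤ x`. -/
noncomputable def L (x : ℝ) : ℕ := Set.ncard {m | m ∈ LuckySet ∧ (m : ℝ) ≤ x}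

/-- `R i x = #{k ∈ A_{i-1} : k ≤ x}`. -/
noncomputable def R (i : ℕ) (x : ℝ) : ℕ := Set.ncard {m | m ∈ A (i - 1) ∧ (m : ℝ) ≤ x}

/-- `𝕃 = {l 1, l 2, l 3, …} = {2, 3, 7, 9, 13, …}`. -/
noncomputable def Ell : Set ℕ := {a | ∃ i, 1 ≤ i ∧ l i = a}

/-- `starIdx i m` : the `m`-th number deleted at step `i` of the sieve, i.e. the
`(l i * m)`-th smallest element of `A (i-1)` (`Nat.nth` is 0-indexed). -/
noncomputable def starIdx (i m : ℕ) : ℕ := Nat.nth (· ∈ A (i - 1)) (l i * m - 1)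

/-- The binary operation `*` : for `a ∈ 𝕃`, `star a m = a * m` is the `m`-th number
deleted at the (unique) step `i ≥ 1` with `l i = a`. -/
noncomputable def star (a m : ℕ) : ℕ := starIdx (sInf {i | 1 ≤ i ∧ l i = a}) m

/-- `evalStar [a₁, …, a_k] = a₁ * (a₂ * (⋯ * a_k)⋯)`. -/
noncomputable def evalStar : List ℕ → ℕ
  | [] => 1
  | [a] => a
  | a :: b :: rest => star a (evalStar (b :: rest))

/-- `t = (a₁, …, a_k)` is a lucky factorization of `n` : `k ≥ 1`, `a_j ∈ 𝕃` for `j < k`,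
`a_k` is a lucky number (possibly 1), and `n = a₁*(a₂*(⋯*a_k)⋯)`. -/
def IsLuckyFactorization (n : ℕ) (t : List ℕ) : Prop :=
  t ≠ [] ∧ (∀ a ∈ t.dropLast, a ∈ Ell) ∧ t.getLast! ∈ LuckySet ∧ evalStar t = n

/-- The canonical tuple of `n` given by the fundamental theorem of arithmetic
for lucky numbers. -/
noncomputable def canonicalTuple (n : ℕ) : List ℕ :=
  haveI := Classical.propDecidable (∃ t, IsLuckyFactorization n t)
  if h : ∃ t, IsLuckyFactorization n t then h.choose else []

/-- `Ω°(n)` : the length of the canonical tuple of `n`. -/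
noncomputable def bigOmega (n : ℕ) : ℕ := (canonicalTuple n).length

/-- `ω°(n)` : the number of distinct entries of the canonical tuple of `n`. -/
noncomputable def smallOmega (n : ℕ) : ℕ := (canonicalTuple n).dedup.length

/-- `d°(n)` : the number of distinct nonempty contiguous subtuples (infixes) of the
canonical tuple of `n`. -/
noncomputable def dCirc (n : ℕ) : ℕ :=
  Set.ncard {s : List ℕ | s ≠ [] ∧ s <:+: canonicalTuple n}

/-- `B` : positive integers whose canonical tuple has last entry `≠ 1`. -/
noncomputable def Bset : Set ℕ := {n | 1 ≤ n ∧ (canonicalTuple n).getLast! ≠ 1}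

/-- `C` : positive integers whose canonical tuple ends with the pair `(2, 1)`. -/
noncomputable def Cset : Set ℕ := {n | 1 ≤ n ∧ ∃ t, canonicalTuple n = t ++ [2, 1]}

/-- `S = B ∪ C`. -/
noncomputable def Sset : Set ℕ := Bset ∪ Cset

/-- The `𝕃`-tuple of `a ∈ S` : the canonical tuple of `a` if it does not end in `1`,
else the canonical tuple with the final `1` removed (so it ends in `2`). -/
noncomputable def ellTuple (a : ℕ) : List ℕ :=
  if (canonicalTuple a).getLast! = 1 then (canonicalTuple a).dropLast else canonicalTuple a

/-- The extended operation `∘` : if the `𝕃`-tuple of `a` is `(t₁, …, t_k)`, then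
`a ∘ b = t₁*(t₂*(⋯*(t_k*b)⋯))`. -/
noncomputable def circ (a b : ℕ) : ℕ := (ellTuple a).foldr star b


theorem rank_finite (B : Set ℕ) (k : ℕ) : {m | m ∈ B ∧ m ≤ k}.Finite :=
  (Set.finite_Iic k).subset fun _ h => h.2

theorem rank_mono (B : Set ℕ) {a b : ℕ} (h : a ≤ b) : rank B a ≤ rank B b :=
  Set.ncard_le_ncard (fun _ hm => ⟨hm.1, hm.2.trans h⟩) (rank_finite B b)

theorem rank_zero {B : Set ℕ} (h : 0 ∉ B) : rank B 0 = 0 := by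
  have : {m | m ∈ B ∧ m ≤ 0} = ∅ := by
    ext m
    simp only [Set.mem_ofPred_eq, Set.mem_empty_iff_false, iff_false, not_and]
    rintro hm h0
    obtain rfl : m = 0 := by omega
    exact h hm
  rw [rank, this, Set.ncard_empty]

theorem rank_succ_of_mem {B : Set ℕ} {n : ℕ} (h : n + 1 ∈ B) :
    rank B (n + 1) = rank B n + 1 := by
  have : {m | m ∈ B ∧ m ≤ n + 1} = insert (n + 1) {m | m ∈ B ∧ m ≤ n} := by
    ext m
    simp only [Set.mem_ofPred_eq, Set.mem_insert_iff]
    constructor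
    · rintro ⟨h1, h2⟩
      by_cases h3 : m = n + 1
      · exact Or.inl h3
      · exact Or.inr ⟨h1, by omega⟩
    · rintro (rfl | ⟨h1, h2⟩)
      · exact ⟨h, le_rfl⟩
      · exact ⟨h1, by omega⟩
  rw [rank, this, Set.ncard_insert_of_notMem _ (rank_finite B n), rank]
  simp

theorem rank_succ_of_notMem {B : Set ℕ} {n : ℕ} (h : n + 1 ∉ B) :
    rank B (n + 1) = rank B n := by
  have : {m | m ∈ B ∧ m ≤ n + 1} = {m | m ∈ B ∧ m ≤ n} := by
    ext m
    simp only [Set.mem_ofPred_eq]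
    constructor
    · rintro ⟨h1, h2⟩
      have h3 : m ≠ n + 1 := by
        rintro rfl
        exact h h1
      exact ⟨h1, by omega⟩
    · rintro ⟨h1, h2⟩
      exact ⟨h1, by omega⟩
  rw [rank, this, rank]

theorem rank_lt_of_mem {B : Set ℕ} {a b : ℕ} (hab : a < b) (hb : b ∈ B) :
    rank B a < rank B b := by
  obtain ⟨c, rfl⟩ : ∃ c, b = c + 1 := ⟨b - 1, by omega⟩
  rw [rank_succ_of_mem hb]
  exact Nat.lt_succ_of_le (rank_mono B (by omega))

theorem exists_mem_of_rank_lt {B : Set ℕ} {a b : ℕ} (h : rank B a < rank B b) :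
    ∃ m ∈ B, a < m ∧ m ≤ b := by
  by_contra! hc
  refine absurd h (not_lt.2 (Set.ncard_le_ncard (fun m hm => ⟨hm.1, ?_⟩) (rank_finite B a)))
  by_contra hma
  exact absurd hm.2 (not_le.2 (hc m hm.1 (not_le.1 hma)))

theorem rank_positive (n : ℕ) : rank {n | 1 ≤ n} n = n := by
  induction n with
  | zero => exact rank_zero (by simp)
  | succ n ih => rw [rank_succ_of_mem (by simp), ih]

/-- A sieve step with parameter `d` turns a rank `c` into `c - ⌊c / d⌋`. -/
theorem rank_step {B : Set ℕ} (h0 : 0 ∉ B) (d n : ℕ) :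
    rank (step B d) n = rank B n - rank B n / d := by
  induction n with
  | zero => rw [rank_zero h0, rank_zero (fun h => h0 h.1)]; simp
  | succ n ih =>
    have hle : rank B n / d ≤ rank B n := Nat.div_le_self _ _
    by_cases hn : n + 1 ∈ B
    · have hs := rank_succ_of_mem hn
      by_cases hd : d ∣ rank B n + 1
      · have hmem : n + 1 ∉ step B d := fun h => h.2 (hs ▸ hd)
        rw [rank_succ_of_notMem hmem, ih, hs, Nat.succ_div, if_pos hd]
        omega
      · have hmem : n + 1 ∈ step B d := ⟨hn, hs ▸ hd⟩
        rw [rank_succ_of_mem hmem, ih, hs, Nat.succ_div, if_neg hd]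
        omega
    · have hmem : n + 1 ∉ step B d := fun h => hn h.1
      rw [rank_succ_of_notMem hn, rank_succ_of_notMem hmem, ih]

theorem A_zero : A 0 = {n | 1 ≤ n} := rfl

theorem A_succ (i : ℕ) : A (i + 1) = step (A i) (l (i + 1)) := rfl

theorem A_succ_subset (i : ℕ) : A (i + 1) ⊆ A i := fun _ h => h.1

theorem A_antitone : Antitone A := antitone_nat_of_succ_le A_succ_subset

theorem zero_notMem_A (i : ℕ) : 0 ∉ A i := fun h => by
  simpa [A_zero] using A_antitone (Nat.zero_le i) h

theorem rank_A_succ (i n : ℕ) :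
    rank (A (i + 1)) n = rank (A i) n - rank (A i) n / l (i + 1) :=
  rank_step (zero_notMem_A i) _ n

theorem l_succ_spec_of_unbounded {i : ℕ} (h : ∀ b, ∃ n, b ≤ rank (A i) n) :
    l (i + 1) ∈ A i ∧ l i < l (i + 1) := by
  obtain ⟨n, hn⟩ := h (rank (A i) (l i) + 1)
  obtain ⟨m, hm, hlt, -⟩ := exists_mem_of_rank_lt (Nat.lt_of_succ_le hn)
  exact Nat.sInf_mem (s := {m | m ∈ A i ∧ l i < m}) ⟨m, hm, hlt⟩

theorem A_unbounded_and_le_l (i : ℕ) : (∀ b, ∃ n, b ≤ rank (A i) n) ∧ i + 1 ≤ l i := by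
  induction i with
  | zero => exact ⟨fun b => ⟨b, (rank_positive b).ge⟩, le_rfl⟩
  | succ i ih =>
    have hl : i + 2 ≤ l (i + 1) := by
      have := (l_succ_spec_of_unbounded ih.1).2
      omega
    refine ⟨fun b => ?_, hl⟩
    obtain ⟨n, hn⟩ := ih.1 (2 * b)
    refine ⟨n, ?_⟩
    have : rank (A i) n / l (i + 1) ≤ rank (A i) n / 2 := Nat.div_le_div_left (by omega) (by simp)
    rw [rank_A_succ]
    omega

theorem le_l (i : ℕ) : i + 1 ≤ l i := (A_unbounded_and_le_l i).2

theorem l_succ_mem (i : ℕ) : l (i + 1) ∈ A i :=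
  (l_succ_spec_of_unbounded (A_unbounded_and_le_l i).1).1

theorem l_lt_l_succ (i : ℕ) : l i < l (i + 1) :=
  (l_succ_spec_of_unbounded (A_unbounded_and_le_l i).1).2

theorem l_one : l 1 = 2 := by
  have h : 2 ≤ l 1 := le_l 1
  have : l 1 ≤ 2 := Nat.sInf_le ⟨show 1 ≤ 2 by norm_num, show 1 < 2 by norm_num⟩
  omega

theorem odd_of_mem_A {i k : ℕ} (hi : 1 ≤ i) (hk : k ∈ A i) : ¬ 2 ∣ k := by
  have h : k ∈ A (0 + 1) := A_antitone hi hk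
  rw [A_succ, zero_add, l_one, A_zero] at h
  have h2 := h.2
  rwa [rank_positive] at h2

theorem l_add_two_le {i : ℕ} (hi : 2 ≤ i) : l i + 2 ≤ l (i + 1) := by
  obtain ⟨j, rfl⟩ : ∃ j, i = j + 1 := ⟨i - 1, by omega⟩
  have h1 := odd_of_mem_A (by omega) (l_succ_mem j)
  have h2 := odd_of_mem_A (by omega) (l_succ_mem (j + 1))
  have h3 := l_lt_l_succ (j + 1)
  omega

/-- `r + d` is the rank of the right end of an interval holding at least `d` survivors, `r` the
rank of its left end and `m` the next sieve parameter; the condition guarantees that at least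
`2 * (r / m) + 1` of the survivors remain when the quotient `r / m` next drops. -/
def Persistent (r m d : ℕ) : Prop :=
  d ≤ m ∧ 2 * (r / m) + 1 ≤ d ∧
    (r + d < (r / m + 1) * m ∨
      (3 * (r / m) + 2) * (2 * (r / m) + 2) + d + r ≤
        (3 * (r / m) + 2) * d + (r / m + 1) * m)

theorem persistent_of_two_mul_add_three_le {r m d : ℕ} (hm : 0 < m) (hd : d ≤ m)
    (h : 2 * (r / m) + 3 ≤ d) : Persistent r m d := by
  have hr : r < (r / m + 1) * m := by
    rw [mul_comm]; exact Nat.lt_mul_div_succ r hm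
  refine ⟨hd, by omega, Or.inr ?_⟩
  obtain ⟨t, ht⟩ := Nat.exists_eq_add_of_le h
  generalize r / m = k at *
  subst ht
  nlinarith [Nat.zero_le (k * t)]

theorem Persistent.next {r m d m' : ℕ} (hm : 0 < m) (hm' : m + 2 ≤ m') (h : Persistent r m d) :
    ∃ d', (r - r / m) + d' ≤ (r + d) - (r + d) / m ∧ Persistent (r - r / m) m' d' := by
  obtain ⟨hdm, hkd, hor⟩ := h
  have hr : r < (r / m + 1) * m := by
    rw [mul_comm]; exact Nat.lt_mul_div_succ r hm
  have hr2 : r / m * m ≤ r := Nat.div_mul_le_self r m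
  have hkr : r / m ≤ r := Nat.div_le_self r m
  have hk' : (r - r / m) / m' ≤ r / m :=
    (Nat.div_le_div_right (Nat.sub_le _ _)).trans (Nat.div_le_div_left (by omega) hm)
  set k := r / m
  have hstep : ∃ d', (r - k) + d' ≤ (r + d) - (r + d) / m ∧ d' ≤ d ∧ 2 * k + 1 ≤ d' ∧
      (r - k + d' < (k + 1) * m' ∨
        (3 * k + 2) * (2 * k + 2) + d' + (r - k) ≤ (3 * k + 2) * d' + (k + 1) * m') := by
    have hmm : (k + 1) * (m + 2) ≤ (k + 1) * m' := Nat.mul_le_mul_left _ hm'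
    by_cases hlt : r + d < (k + 1) * m
    · refine ⟨d, ?_, le_rfl, hkd, Or.inl ?_⟩
      · have : (r + d) / m < k + 1 := (Nat.div_lt_iff_lt_mul hm).2 hlt
        omega
      · nlinarith [Nat.sub_le r k]
    · have hc := hor.resolve_left hlt
      have hd2 : 2 * k + 2 ≤ d := by
        by_contra hcon
        have h1 : d = 2 * k + 1 := by omega
        rw [h1] at hc hlt
        nlinarith
      refine ⟨d - 1, ?_, by omega, by omega, Or.inr ?_⟩
      · have : (r + d) / m < k + 2 := (Nat.div_lt_iff_lt_mul hm).2 (by nlinarith)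
        omega
      · obtain ⟨e, rfl⟩ : ∃ e, d = e + 1 := ⟨d - 1, by omega⟩
        obtain ⟨s, hs⟩ : ∃ s, r = s + k := ⟨r - k, by omega⟩
        have h1 : r - k = s := by omega
        rw [h1, Nat.add_sub_cancel]
        nlinarith
  obtain ⟨d', h1, h2, h3, h4⟩ := hstep
  refine ⟨d', h1, ?_⟩
  rcases hk'.eq_or_lt with heq | hlt
  · exact ⟨by omega, by omega, by rw [heq]; exact h4⟩
  · exact persistent_of_two_mul_add_three_le (by omega) (by omega) (by omega)

theorem exists_lucky_of_persistent {I x y d : ℕ} (hI : 2 ≤ I)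
    (hd : rank (A I) x + d ≤ rank (A I) y) (h : Persistent (rank (A I) x) (l (I + 1)) d) :
    ∃ n ∈ LuckySet, x < n ∧ n ≤ y := by
  have key : ∀ i, I ≤ i → ∃ d, rank (A i) x + d ≤ rank (A i) y ∧
      Persistent (rank (A i) x) (l (i + 1)) d := by
    intro i hi
    induction i, hi using Nat.le_induction with
    | base => exact ⟨d, hd, h⟩
    | succ i hi ih =>
      obtain ⟨e, he, hp⟩ := ih
      have hpos : 0 < l (i + 1) := by have := le_l (i + 1); omega
      obtain ⟨e', he', hp'⟩ := hp.next hpos (l_add_two_le (i := i + 1) (by omega))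
      refine ⟨e', ?_, ?_⟩
      · rw [rank_A_succ, rank_A_succ]
        have hmono : ∀ a b m : ℕ, a ≤ b → a - a / m ≤ b - b / m := by
          intro a b m hab
          induction b, hab using Nat.le_induction with
          | base => exact le_rfl
          | succ b _ ih =>
            refine ih.trans ?_
            rw [Nat.succ_div]
            have := Nat.div_le_self b m
            split_ifs <;> omega
        exact he'.trans (hmono _ _ _ he)
      · rw [rank_A_succ]
        exact hp'
  by_contra! hc
  have hex : ∀ n, ∃ i, x < n → n ≤ y → n ∉ A i := by
    intro n
    by_cases hn : n ∈ LuckySet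
    · exact ⟨0, fun h1 h2 => absurd h2 (not_le.2 (hc n hn h1))⟩
    · simp only [LuckySet, Set.mem_iInter, not_forall] at hn
      obtain ⟨i, hi⟩ := hn
      exact ⟨i, fun _ _ => hi⟩
  choose f hf using hex
  set T := I + ∑ n ∈ Finset.range (y + 1), f n
  obtain ⟨e, he, -, hke, -⟩ := key T (by omega)
  obtain ⟨n, hn, hxn, hny⟩ := exists_mem_of_rank_lt (B := A T) (a := x) (b := y) (by omega)
  have : f n ≤ ∑ n ∈ Finset.range (y + 1), f n :=
    Finset.single_le_sum (fun _ _ => Nat.zero_le _) (Finset.mem_range.2 (by omega))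
  exact hf n hxn hny (A_antitone (by omega) hn)

/-- The density `∏ j ≤ i, (1 - 1 / l j)` of `A i`. -/
noncomputable def density : ℕ → ℝ
  | 0 => 1
  | i + 1 => density i * (1 - 1 / (l (i + 1) : ℝ))

theorem one_div_l_bounds (i : ℕ) :
    0 < 1 / (l (i + 1) : ℝ) ∧ 1 / (l (i + 1) : ℝ) ≤ 1 / ((i : ℝ) + 2) := by
  have h : ((i + 1 + 1 : ℕ) : ℝ) ≤ l (i + 1) := by exact_mod_cast le_l (i + 1)
  push_cast at h
  have hi : (0 : ℝ) ≤ i := Nat.cast_nonneg i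
  exact ⟨by apply one_div_pos.2; linarith, one_div_le_one_div_of_le (by linarith) (by linarith)⟩

theorem one_div_l_le_half (i : ℕ) : 1 / (l (i + 1) : ℝ) ≤ 1 / 2 := by
  refine (one_div_l_bounds i).2.trans (one_div_le_one_div_of_le (by norm_num) ?_)
  have hi : (0 : ℝ) ≤ i := Nat.cast_nonneg i
  linarith

theorem density_pos (i : ℕ) : 0 < density i := by
  induction i with
  | zero => exact one_pos
  | succ i ih => exact mul_pos ih (by have := one_div_l_le_half i; linarith)

theorem density_le_one (i : ℕ) : density i ≤ 1 := by
  induction i with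
  | zero => exact le_rfl
  | succ i ih =>
    have h1 := one_div_l_le_half i
    have h2 := (one_div_l_bounds i).1
    exact mul_le_one₀ ih (by linarith) (by linarith)

theorem succ_mul_density_mono : Monotone fun i : ℕ => ((i : ℝ) + 1) * density i := by
  refine monotone_nat_of_le_succ fun i => ?_
  have h := (one_div_l_bounds i).2
  have hd := density_pos i
  have hi : (0 : ℝ) ≤ i := Nat.cast_nonneg i
  have h2 : (i : ℝ) + 1 ≤ ((i : ℝ) + 2) * (1 - 1 / (l (i + 1) : ℝ)) := by
    have : ((i : ℝ) + 2) * (1 / (l (i + 1) : ℝ)) ≤ 1 := by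
      exact (mul_le_mul_of_nonneg_left h (by linarith)).trans
        (mul_one_div_cancel (show (i : ℝ) + 2 ≠ 0 by positivity)).le
    linarith
  simp only [density]
  push_cast
  nlinarith [mul_le_mul_of_nonneg_left h2 hd.le]

theorem cast_div_bounds (a m : ℕ) :
    (a : ℝ) * (1 / (m : ℝ)) - 1 ≤ ((a / m : ℕ) : ℝ) ∧
      ((a / m : ℕ) : ℝ) ≤ (a : ℝ) * (1 / (m : ℝ)) := by
  rw [mul_one_div]
  refine ⟨?_, Nat.cast_div_le⟩
  rw [← Nat.floor_div_eq_div (K := ℝ)]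
  exact (Nat.sub_one_lt_floor _).le

theorem rank_A_succ_cast (i n : ℕ) :
    (rank (A (i + 1)) n : ℝ) = rank (A i) n - ((rank (A i) n / l (i + 1) : ℕ) : ℝ) := by
  rw [rank_A_succ, Nat.cast_sub (Nat.div_le_self _ _)]

theorem rank_A_le (i n : ℕ) : (rank (A i) n : ℝ) ≤ density i * n + i := by
  induction i with
  | zero => rw [A_zero, rank_positive]; simp [density]
  | succ i ih =>
    have h1 := (cast_div_bounds (rank (A i) n) (l (i + 1))).1
    have h2 := one_div_l_le_half i
    have h3 := (one_div_l_bounds i).1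
    have hi : (0 : ℝ) ≤ i := Nat.cast_nonneg i
    rw [rank_A_succ_cast, density]
    push_cast
    nlinarith [mul_le_mul_of_nonneg_right ih (show 0 ≤ 1 - 1 / (l (i + 1) : ℝ) by linarith),
      mul_nonneg hi h3.le]

theorem le_rank_A_sub (i x h : ℕ) :
    density i * h - i ≤ (rank (A i) (x + h) : ℝ) - rank (A i) x := by
  induction i with
  | zero => rw [A_zero, rank_positive, rank_positive]; simp [density]
  | succ i ih =>
    have h0 := (cast_div_bounds (rank (A i) (x + h)) (l (i + 1))).2
    have h1 := (cast_div_bounds (rank (A i) x) (l (i + 1))).1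
    have h2 := one_div_l_le_half i
    have h3 := (one_div_l_bounds i).1
    have hi : (0 : ℝ) ≤ i := Nat.cast_nonneg i
    rw [rank_A_succ_cast, rank_A_succ_cast, density]
    push_cast
    nlinarith [mul_le_mul_of_nonneg_right ih (show 0 ≤ 1 - 1 / (l (i + 1) : ℝ) by linarith),
      mul_nonneg hi h3.le]

theorem sub_le_rank_A_l {J I : ℕ} (h : J ≤ I) : I ≤ rank (A J) (l I) + J := by
  induction I, h using Nat.le_induction with
  | base => omega
  | succ I hI ih =>
    have := rank_lt_of_mem (l_lt_l_succ I) (A_antitone hI (l_succ_mem I))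
    omega

theorem le_density_mul_l (I : ℕ) : (I : ℝ) ≤ 8 * (density I * l I) := by
  set J := I / 4 with hJ
  have hJ4 : 4 * (J : ℝ) ≤ I := by
    have : 4 * J ≤ I := by omega
    exact_mod_cast this
  have hI4 : (I : ℝ) + 1 ≤ 4 * ((J : ℝ) + 1) := by
    have : I + 1 ≤ 4 * (J + 1) := by omega
    exact_mod_cast this
  have h1 : (I : ℝ) ≤ rank (A J) (l I) + J := by
    exact_mod_cast sub_le_rank_A_l (show J ≤ I by omega)
  have h2 := rank_A_le J (l I)
  have h3 : ((J : ℝ) + 1) * density J ≤ ((I : ℝ) + 1) * density I :=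
    succ_mul_density_mono (show J ≤ I by omega)
  have hdI := density_pos I
  have hJ0 : (0 : ℝ) ≤ J := Nat.cast_nonneg J
  have h4 : density J ≤ 4 * density I := by
    have : ((J : ℝ) + 1) * density J ≤ ((J : ℝ) + 1) * (4 * density I) := by nlinarith
    exact le_of_mul_le_mul_left this (by linarith)
  have hl : (0 : ℝ) ≤ l I := Nat.cast_nonneg _
  nlinarith [mul_le_mul_of_nonneg_right h4 hl]

/-- Above any `N ≥ 100` there is a lucky number at distance `O(√N)`. -/
theorem exists_lucky_of_sqrt_le {N H : ℕ} (hN : 100 ≤ N) (hH : 97 * √(N : ℝ) ≤ H) :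
    ∃ n ∈ LuckySet, N < n ∧ n ≤ N + H := by
  set s := √(N : ℝ)
  have hs10 : 10 ≤ s := by
    apply Real.le_sqrt_of_sq_le
    have : (100 : ℝ) ≤ N := by exact_mod_cast hN
    linarith
  have hss : s * s = N := Real.mul_self_sqrt (Nat.cast_nonneg N)
  have hex : ∃ i, 2 * s ≤ (l (i + 1) : ℝ) := by
    obtain ⟨k, hk⟩ := exists_nat_ge (2 * s)
    refine ⟨k, hk.trans ?_⟩
    exact_mod_cast (show k ≤ l (k + 1) by have := le_l (k + 1); omega)
  classical
  obtain ⟨I, hI, hmin⟩ : ∃ I, 2 * s ≤ (l (I + 1) : ℝ) ∧ ∀ j < I, (l (j + 1) : ℝ) < 2 * s :=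
    ⟨Nat.find hex, Nat.find_spec hex, fun j hj => not_le.1 (Nat.find_min hex hj)⟩
  have hl2 : l 2 ≤ 3 :=
    Nat.sInf_le ⟨⟨show 1 ≤ 3 by norm_num, by
      change ¬ l 1 ∣ rank (A 0) 3
      rw [A_zero, rank_positive, l_one]; norm_num⟩, by change l 1 < 3; rw [l_one]; norm_num⟩
  have hI2 : 2 ≤ I := by
    by_contra hcon
    have h2 : l (I + 1) ≤ 3 := by
      have : I = 0 ∨ I = 1 := by omega
      rcases this with rfl | rfl
      · exact l_one.le.trans (by norm_num)
      · exact hl2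
    have h3 : (l (I + 1) : ℝ) ≤ 3 := by exact_mod_cast h2
    linarith
  have hlI : (l I : ℝ) < 2 * s := by
    have := hmin (I - 1) (by omega)
    rwa [Nat.sub_add_cancel (by omega)] at this
  have hIl : (I : ℝ) ≤ l (I + 1) := by
    exact_mod_cast (show I ≤ l (I + 1) by have := le_l (I + 1); omega)
  have hpos : 0 < l (I + 1) := by have := le_l (I + 1); omega
  have hI2' : (2 : ℝ) ≤ I := by exact_mod_cast hI2
  have hdpos := density_pos I
  have hd1 := density_le_one I
  have hId := le_density_mul_l I
  have hr := rank_A_le I N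
  have hD := le_rank_A_sub I N H
  set r := rank (A I) N
  set m := l (I + 1)
  set k := r / m
  have hmr : (0 : ℝ) < m := by exact_mod_cast hpos
  -- the quotient is at most `density I * s / 2 + 1`
  have hkle : (k : ℝ) ≤ density I * s / 2 + 1 := by
    have hkm : (k : ℝ) * m ≤ r := by exact_mod_cast Nat.div_mul_le_self r m
    have h1 : density I * N ≤ density I * s / 2 * m := by
      rw [← hss]
      nlinarith [mul_le_mul_of_nonneg_left hI (mul_nonneg hdpos.le (by linarith : 0 ≤ s))]
    exact le_of_mul_le_mul_right (by linarith : (k : ℝ) * m ≤ (density I * s / 2 + 1) * m) hmr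
  have hId' : (I : ℝ) ≤ 16 * (density I * s) := by
    nlinarith [mul_le_mul_of_nonneg_left hlI.le hdpos.le]
  refine exists_lucky_of_persistent (d := 2 * k + 3) hI2 ?_
    (persistent_of_two_mul_add_three_le hpos ?_ le_rfl)
  · have : (r : ℝ) + (2 * k + 3) ≤ rank (A I) (N + H) := by
      nlinarith [mul_le_mul_of_nonneg_left hH hdpos.le]
    exact_mod_cast this
  · have : (2 * k + 3 : ℝ) ≤ m := by
      nlinarith [mul_le_mul_of_nonneg_right hd1 (by linarith : 0 ≤ s)]
    exact_mod_cast this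

/-- there exist `C > 0` and a real `X₀` such that for every real `x ≥ X₀`
there is a lucky number `l` with `x ≤ l ≤ x + C·√(x·log x)`. -/
theorem lucky_in_short_interval :
    ∃ C : ℝ, 0 < C ∧ ∃ X₀ : ℝ, ∀ x : ℝ, X₀ ≤ x →
      ∃ n ∈ LuckySet, x ≤ (n : ℝ) ∧ (n : ℝ) ≤ x + C * Real.sqrt (x * Real.log x) := by
  refine ⟨98, by norm_num, 101, fun x hx => ?_⟩
  have hx0 : 0 ≤ x := by linarith
  have hN : 100 ≤ ⌊x⌋₊ := Nat.le_floor (by push_cast; linarith)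
  obtain ⟨n, hn, h1, h2⟩ :=
    exists_lucky_of_sqrt_le (H := ⌈97 * √(⌊x⌋₊ : ℝ)⌉₊) hN (Nat.le_ceil _)
  refine ⟨n, hn, ((Nat.floor_lt hx0).1 h1).le, ?_⟩
  have hfl : (⌊x⌋₊ : ℝ) ≤ x := Nat.floor_le hx0
  have hceil := (Nat.ceil_lt_add_one (show 0 ≤ 97 * √(⌊x⌋₊ : ℝ) by positivity)).le
  have hsq : √(⌊x⌋₊ : ℝ) ≤ √x := Real.sqrt_le_sqrt hfl
  have hlog : 1 ≤ Real.log x := by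
    rw [Real.le_log_iff_exp_le (by linarith)]
    linarith [Real.exp_one_lt_d9]
  have hsl : √x ≤ √(x * Real.log x) := Real.sqrt_le_sqrt (by nlinarith)
  have hs1 : 1 ≤ √x := Real.one_le_sqrt.2 (by linarith)
  have h2' : (n : ℝ) ≤ ⌊x⌋₊ + ⌈97 * √(⌊x⌋₊ : ℝ)⌉₊ := by exact_mod_cast h2
  linarith

end LuckyPaper
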